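/- Let G be an m×n XOR game with no zero rows and no zero columns, with marginal row biases c_1,…,c_m and marginal column biases d_1,…,d_n. Let {A_i},{B_j},ψ be a finite-dimensional quantum strategy for G that is optimal and nondegenerate, and let λ be the d₂×d₁ matrix with ψ = ∑_i e_i ⊗ (λ e_i) and ρ = λλᴴ the marginal density matrix on ℂ^{d₂}. Then: (a) ρ commutes with every B_j; (b) ρ is positive definite (invertible); and (c) (∑_{j=1}^n G_{ij} B_j)² = c_i² I for every 1 ≤ i ≤ m. -/

import Mathlib

open scoped BigOperators RealInnerProductSpace ComplexOrder
open Matrix Kronecker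

noncomputable section

/-- An XOR game is given by a cost matrix whose absolute entries sum to 1. -/
def isXORGame {ι κ : Type*} [Fintype ι] [Fintype κ] (G : Matrix ι κ ℝ) : Prop :=
  ∑ i, ∑ j, |G i j| = 1

/-- The bias of a vector strategy. -/
def stratBias {ι κ : Type*} [Fintype ι] [Fintype κ] (G : Matrix ι κ ℝ) {N : ℕ}
    (u : ι → EuclideanSpace ℝ (Fin N)) (v : κ → EuclideanSpace ℝ (Fin N)) : ℝ :=
  ∑ i, ∑ j, G i j * ⟪u i, v j⟫

/-- The quantum bias of an XOR game: supremum of biases of vector strategies. -/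
def quantumBias {ι κ : Type*} [Fintype ι] [Fintype κ] (G : Matrix ι κ ℝ) : ℝ :=
  sSup {b : ℝ | ∃ (N : ℕ) (u : ι → EuclideanSpace ℝ (Fin N))
      (v : κ → EuclideanSpace ℝ (Fin N)),
    (∀ i, ‖u i‖ = 1) ∧ (∀ j, ‖v j‖ = 1) ∧ stratBias G u v = b}

/-- Objective function of the optimization problem (Γ). -/
def gammaObj {ι κ : Type*} [Fintype ι] [Fintype κ] (G : Matrix ι κ ℝ)
    (V : Matrix κ κ ℝ) : ℝ :=
  ∑ i, Real.sqrt (∑ j, ∑ k, G i j * G i k * V j k)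

/-- `V` is an optimal solution of (Γ). -/
def gammaOptimal {ι κ : Type*} [Fintype ι] [Fintype κ] (G : Matrix ι κ ℝ)
    (V : Matrix κ κ ℝ) : Prop :=
  V.PosSemidef ∧ (∀ j, V j j = 1) ∧
    ∀ W : Matrix κ κ ℝ, W.PosSemidef → (∀ j, W j j = 1) → gammaObj G W ≤ gammaObj G V

/-- `c` is the family of marginal row biases of `G`. -/
def isMarginalRowBiases {ι κ : Type*} [Fintype ι] [Fintype κ] (G : Matrix ι κ ℝ)
    (c : ι → ℝ) : Prop :=
  (∀ i, 0 ≤ c i) ∧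
  ∀ (N : ℕ) (u : ι → EuclideanSpace ℝ (Fin N)) (v : κ → EuclideanSpace ℝ (Fin N)),
    (∀ i, ‖u i‖ = 1) → (∀ j, ‖v j‖ = 1) → stratBias G u v = quantumBias G →
    ∀ i, ∑ j, G i j * ⟪u i, v j⟫ = c i

/-- `d` is the family of marginal column biases of `G`. -/
def isMarginalColBiases {ι κ : Type*} [Fintype ι] [Fintype κ] (G : Matrix ι κ ℝ)
    (d : κ → ℝ) : Prop :=
  (∀ j, 0 ≤ d j) ∧
  ∀ (N : ℕ) (u : ι → EuclideanSpace ℝ (Fin N)) (v : κ → EuclideanSpace ℝ (Fin N)),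
    (∀ i, ‖u i‖ = 1) → (∀ j, ‖v j‖ = 1) → stratBias G u v = quantumBias G →
    ∀ j, ∑ i, G i j * ⟪u i, v j⟫ = d j

/-- Hermitian inner product on `ι → ℂ`. -/
def cinner {ι : Type*} [Fintype ι] (x y : ι → ℂ) : ℂ := ∑ i, star (x i) * y i

/-- Hilbert space norm on `ι → ℂ`. -/
def cnorm {ι : Type*} [Fintype ι] (x : ι → ℂ) : ℝ := Real.sqrt (∑ i, ‖x i‖ ^ 2)

/-- Frobenius norm of a complex matrix. -/
def frobNorm {ι κ : Type*} [Fintype ι] [Fintype κ] (M : Matrix ι κ ℂ) : ℝ :=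
  Real.sqrt (∑ i, ∑ j, ‖M i j‖ ^ 2)

/-- Operator norm of a complex square matrix. -/
def opNorm {ι : Type*} [Fintype ι] [DecidableEq ι] (M : Matrix ι ι ℂ) : ℝ :=
  ‖Matrix.toEuclideanCLM (𝕜 := ℂ) M‖

/-- Bias of a quantum strategy. -/
def qStratBias {ι κ : Type*} [Fintype ι] [Fintype κ] {d₁ d₂ : ℕ} (G : Matrix ι κ ℝ)
    (A : ι → Matrix (Fin d₁) (Fin d₁) ℂ) (B : κ → Matrix (Fin d₂) (Fin d₂) ℂ)
    (ψ : Fin d₁ × Fin d₂ → ℂ) : ℂ :=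
  ∑ i, ∑ j, (G i j : ℂ) * cinner ψ ((A i ⊗ₖ B j).mulVec ψ)

/-- Nondegeneracy of a quantum strategy. -/
def Nondegenerate {ι κ : Type*} {d₁ d₂ : ℕ}
    (A : ι → Matrix (Fin d₁) (Fin d₁) ℂ) (B : κ → Matrix (Fin d₂) (Fin d₂) ℂ)
    (ψ : Fin d₁ × Fin d₂ → ℂ) : Prop :=
  (¬ ∃ P : Matrix (Fin d₁) (Fin d₁) ℂ, P ≠ 1 ∧ P.IsHermitian ∧ P * P = P ∧
      (∀ i, P * A i = A i * P) ∧ (P ⊗ₖ (1 : Matrix (Fin d₂) (Fin d₂) ℂ)).mulVec ψ = ψ) ∧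
  (¬ ∃ Q : Matrix (Fin d₂) (Fin d₂) ℂ, Q ≠ 1 ∧ Q.IsHermitian ∧ Q * Q = Q ∧
      (∀ j, Q * B j = B j * Q) ∧ ((1 : Matrix (Fin d₁) (Fin d₁) ℂ) ⊗ₖ Q).mulVec ψ = ψ)

theorem norm_update_eq_one {κ : Type*} [DecidableEq κ] {N : ℕ} {v : κ → EuclideanSpace ℝ (Fin N)}
    (hv : ∀ j, ‖v j‖ = 1) (j : κ) {x : EuclideanSpace ℝ (Fin N)} (hx : ‖x‖ = 1) (k : κ) :
    ‖Function.update v j x k‖ = 1 := by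
  rcases eq_or_ne k j with rfl | h
  · simpa using hx
  · simpa [h] using hv k

section VectorStrategies

variable {ι κ : Type*} [Fintype ι] [Fintype κ] {N : ℕ}

theorem stratBias_transpose (G : Matrix ι κ ℝ)
    (u : ι → EuclideanSpace ℝ (Fin N)) (v : κ → EuclideanSpace ℝ (Fin N)) :
    stratBias Gᵀ v u = stratBias G u v := by
  unfold stratBias
  rw [Finset.sum_comm]
  simp [real_inner_comm]

theorem quantumBias_transpose (G : Matrix ι κ ℝ) : quantumBias Gᵀ = quantumBias G := by
  unfold quantumBias
  congr 1
  ext b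
  constructor
  · rintro ⟨N, v, u, hv, hu, h⟩
    exact ⟨N, u, v, hu, hv, by rw [← stratBias_transpose, h]⟩
  · rintro ⟨N, u, v, hu, hv, h⟩
    exact ⟨N, v, u, hv, hu, by rw [stratBias_transpose, h]⟩

theorem isMarginalRowBiases.transpose {G : Matrix ι κ ℝ} {c : ι → ℝ}
    (hc : isMarginalRowBiases G c) : isMarginalColBiases Gᵀ c := by
  refine ⟨hc.1, fun N v u hv hu h i => ?_⟩
  rw [stratBias_transpose, quantumBias_transpose] at h
  rw [← hc.2 N u v hu hv h i]
  simp [real_inner_comm]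

theorem stratBias_le_quantumBias (G : Matrix ι κ ℝ)
    (u : ι → EuclideanSpace ℝ (Fin N)) (v : κ → EuclideanSpace ℝ (Fin N))
    (hu : ∀ i, ‖u i‖ = 1) (hv : ∀ j, ‖v j‖ = 1) : stratBias G u v ≤ quantumBias G := by
  refine le_csSup ⟨∑ i, ∑ j, |G i j|, ?_⟩ ⟨N, u, v, hu, hv, rfl⟩
  rintro b ⟨N, u, v, hu, hv, rfl⟩
  refine Finset.sum_le_sum fun i _ => Finset.sum_le_sum fun j _ => ?_
  refine (le_abs_self _).trans ?_
  rw [abs_mul]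
  have h := abs_real_inner_le_norm (u i) (v j)
  rw [hu, hv, one_mul] at h
  exact mul_le_of_le_one_right (abs_nonneg _) h

theorem stratBias_eq_sum_inner (G : Matrix ι κ ℝ)
    (u : ι → EuclideanSpace ℝ (Fin N)) (v : κ → EuclideanSpace ℝ (Fin N)) :
    stratBias G u v = ∑ j, ⟪∑ i, G i j • u i, v j⟫ := by
  unfold stratBias
  rw [Finset.sum_comm]
  simp [sum_inner, real_inner_smul_left]

theorem stratBias_update [DecidableEq κ] (G : Matrix ι κ ℝ)
    (u : ι → EuclideanSpace ℝ (Fin N)) (v : κ → EuclideanSpace ℝ (Fin N)) (j : κ)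
    (x : EuclideanSpace ℝ (Fin N)) :
    stratBias G u (Function.update v j x) =
      stratBias G u v + ⟪∑ i, G i j • u i, x⟫ - ⟪∑ i, G i j • u i, v j⟫ := by
  rw [stratBias_eq_sum_inner, stratBias_eq_sum_inner,
    ← Finset.add_sum_erase _ _ (Finset.mem_univ j),
    ← Finset.add_sum_erase _ (fun k => ⟪∑ i, G i k • u i, v k⟫) (Finset.mem_univ j),
    Finset.sum_congr rfl (g := fun k => ⟪∑ i, G i k • u i, v k⟫)]
  · simp only [Function.update_self]
    ring
  · intro k hk
    rw [Function.update_of_ne (Finset.ne_of_mem_erase hk)]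

/-- In an optimal vector strategy, `∑ i, G i j • u i` is the multiple `d j • v j`. -/
theorem isMarginalColBiases.sum_smul_eq {G : Matrix ι κ ℝ} {d : κ → ℝ}
    (hd : isMarginalColBiases G d)
    {u : ι → EuclideanSpace ℝ (Fin N)} {v : κ → EuclideanSpace ℝ (Fin N)}
    (hu : ∀ i, ‖u i‖ = 1) (hv : ∀ j, ‖v j‖ = 1) (h : stratBias G u v = quantumBias G) (j : κ) :
    ∑ i, G i j • u i = d j • v j := by
  classical
  have hdj : ⟪∑ i, G i j • u i, v j⟫ = d j := by
    rw [← hd.2 N u v hu hv h j]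
    simp [sum_inner, real_inner_smul_left]
  have hle : ‖∑ i, G i j • u i‖ ≤ d j := by
    rcases eq_or_ne (∑ i, G i j • u i) 0 with hw | hw
    · rw [hw, norm_zero]
      exact hd.1 j
    · have hx : ‖(‖∑ i, G i j • u i‖⁻¹ • ∑ i, G i j • u i)‖ = 1 := norm_smul_inv_norm hw
      have hb := stratBias_le_quantumBias G u _ hu (norm_update_eq_one hv j hx)
      have hn : ‖∑ i, G i j • u i‖ ≠ 0 := norm_ne_zero_iff.mpr hw
      rw [stratBias_update, h, hdj, real_inner_smul_right, real_inner_self_eq_norm_sq, sq,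
        inv_mul_cancel_left₀ hn] at hb
      linarith
  have hsq : ‖∑ i, G i j • u i - d j • v j‖ ^ 2 ≤ 0 := by
    rw [norm_sub_sq_real, real_inner_smul_right, hdj, norm_smul, hv, mul_one, Real.norm_eq_abs,
      sq_abs]
    nlinarith [norm_nonneg (∑ i, G i j • u i)]
  rw [← sub_eq_zero, ← norm_eq_zero]
  exact pow_eq_zero_iff two_ne_zero |>.mp (le_antisymm hsq (sq_nonneg _))

/-- Column biases of a game with well-defined row biases do not vanish at nonzero columns. -/
theorem isMarginalColBiases.ne_zero {G : Matrix ι κ ℝ} {c : ι → ℝ} {d : κ → ℝ}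
    (hc : isMarginalRowBiases G c) (hd : isMarginalColBiases G d)
    {u : ι → EuclideanSpace ℝ (Fin N)} {v : κ → EuclideanSpace ℝ (Fin N)}
    (hu : ∀ i, ‖u i‖ = 1) (hv : ∀ j, ‖v j‖ = 1) (h : stratBias G u v = quantumBias G)
    {i : ι} {j : κ} (hij : G i j ≠ 0) : d j ≠ 0 := by
  classical
  intro h0
  have hw : ∑ i, G i j • u i = 0 := by rw [hd.sum_smul_eq hu hv h j, h0, zero_smul]
  have key : ∀ x : EuclideanSpace ℝ (Fin N), ‖x‖ = 1 →
      G i j * ⟪u i, x⟫ + ∑ k ∈ Finset.univ.erase j, G i k * ⟪u i, v k⟫ = c i := by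
    intro x hx
    have hopt : stratBias G u (Function.update v j x) = quantumBias G := by
      rw [stratBias_update, hw, h]
      simp
    rw [← hc.2 N u _ hu (norm_update_eq_one hv j hx) hopt i,
      ← Finset.add_sum_erase _ _ (Finset.mem_univ j), Function.update_self]
    congr 1
    refine Finset.sum_congr rfl fun k hk => ?_
    rw [Function.update_of_ne (Finset.ne_of_mem_erase hk)]
  have h1 := key (u i) (hu i)
  have h2 := key (-u i) (by rw [norm_neg, hu])
  rw [inner_neg_right, real_inner_self_eq_norm_sq, hu] at h2
  rw [real_inner_self_eq_norm_sq, hu] at h1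
  exact hij (by linarith)

/-- The optimality relations for vectors in an arbitrary finite-dimensional real inner product
space. -/
theorem marginal_relations {E : Type*} [NormedAddCommGroup E] [InnerProductSpace ℝ E]
    [FiniteDimensional ℝ E] {G : Matrix ι κ ℝ} {c : ι → ℝ} {d : κ → ℝ}
    (hcols : ∀ j, ∃ i, G i j ≠ 0)
    (hc : isMarginalRowBiases G c) (hd : isMarginalColBiases G d)
    {u : ι → E} {v : κ → E} (hu : ∀ i, ‖u i‖ = 1) (hv : ∀ j, ‖v j‖ = 1)
    (h : ∑ i, ∑ j, G i j * ⟪u i, v j⟫ = quantumBias G) :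
    (∀ j, ∑ i, G i j • u i = d j • v j) ∧ (∀ i, ∑ j, G i j • v j = c i • u i) ∧
      ∀ j, d j ≠ 0 := by
  let e := (stdOrthonormalBasis ℝ E).repr
  have hu' : ∀ i, ‖e (u i)‖ = 1 := fun i => by rw [e.norm_map, hu]
  have hv' : ∀ j, ‖e (v j)‖ = 1 := fun j => by rw [e.norm_map, hv]
  have h' : stratBias G (fun i => e (u i)) (fun j => e (v j)) = quantumBias G := by
    simpa only [stratBias, e.inner_map_map] using h
  refine ⟨fun j => e.injective ?_, fun i => e.injective ?_, fun j => ?_⟩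
  · simpa only [map_sum, map_smul] using hd.sum_smul_eq hu' hv' h' j
  · have := hc.transpose.sum_smul_eq (u := fun j => e (v j)) (v := fun i => e (u i)) hv' hu'
      (by rw [stratBias_transpose, h', quantumBias_transpose]) i
    simpa only [map_sum, map_smul, transpose_apply] using this
  · obtain ⟨i, hij⟩ := hcols j
    exact hd.ne_zero hc hu' hv' h' hij

end VectorStrategies

section Vectorization

variable {m n : Type*} [Fintype m] [Fintype n]

theorem inner_toLp_vec (X Y : Matrix m n ℂ) :
    ⟪WithLp.toLp 2 (vec X), WithLp.toLp 2 (vec Y)⟫ = (Xᴴ * Y).trace.re := by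
  rw [← star_vec_dotProduct_vec, dotProduct, Complex.re_sum, PiLp.inner_apply]
  exact Finset.sum_congr rfl fun p _ => by
    rw [Complex.inner, mul_comm]
    rfl

theorem norm_toLp_vec (X : Matrix m n ℂ) : ‖WithLp.toLp 2 (vec X)‖ = frobNorm X := by
  rw [EuclideanSpace.norm_eq, frobNorm, Fintype.sum_prod_type, Finset.sum_comm]
  rfl

theorem frobNorm_sq (X : Matrix m n ℂ) : frobNorm X ^ 2 = (Xᴴ * X).trace.re := by
  rw [← norm_toLp_vec, ← inner_toLp_vec, real_inner_self_eq_norm_sq]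

theorem frobNorm_eq_of_gram_trace_eq {p q : Type*} [Fintype p] [Fintype q]
    {X : Matrix m n ℂ} {Y : Matrix p q ℂ}
    (h : (Xᴴ * X).trace = (Yᴴ * Y).trace) : frobNorm X = frobNorm Y := by
  have hX : 0 ≤ frobNorm X := Real.sqrt_nonneg _
  have hY : 0 ≤ frobNorm Y := Real.sqrt_nonneg _
  rw [← sq_eq_sq₀ hX hY, frobNorm_sq, frobNorm_sq, h]

end Vectorization

/-- If `Q = 1` is the only projection commuting with all `B j` that fixes `lam`, and `lam * lamᴴ`
commutes with all `B j`, then `lam * lamᴴ` is positive definite. -/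
theorem posDef_mul_conjTranspose_of_commute {κ p q : Type*} [Fintype p] [DecidableEq p] [Fintype q]
    {B : κ → Matrix p p ℂ} {lam : Matrix p q ℂ}
    (hcomm : ∀ j, lam * lamᴴ * B j = B j * (lam * lamᴴ))
    (hQ : ∀ Q : Matrix p p ℂ, Q.IsHermitian → Q * Q = Q → (∀ j, Q * B j = B j * Q) →
      Q * lam = lam → Q = 1) : (lam * lamᴴ).PosDef := by
  have hpos : (lam * lamᴴ).PosSemidef := posSemidef_self_mul_conjTranspose lam
  have hsa : IsSelfAdjoint (lam * lamᴴ) := hpos.isHermitian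
  have hcont : ∀ f : ℝ → ℝ, ContinuousOn f (spectrum ℝ (lam * lamᴴ)) := fun f =>
    (Matrix.finite_real_spectrum).continuousOn f
  let f : ℝ → ℝ := fun x => x⁻¹ * x
  have hf : cfc f (lam * lamᴴ) = cfc (fun x : ℝ => x⁻¹) (lam * lamᴴ) * (lam * lamᴴ) := by
    rw [cfc_mul (fun x : ℝ => x⁻¹) (fun x => x) _ (hcont _) (hcont _),
      cfc_id' ℝ (lam * lamᴴ) hsa]
  have h1 : cfc f (lam * lamᴴ) = 1 := by
    refine hQ _ (cfc_predicate f _) ?_ (fun j => Commute.cfc_real (hcomm j) f) ?_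
    · rw [← cfc_mul f f _ (hcont _) (hcont _)]
      congr 1
      ext x
      by_cases hx : x = 0 <;> simp [f, hx]
    · suffices h : (cfc f (lam * lamᴴ) - 1) * lam = 0 by
        rwa [Matrix.sub_mul, Matrix.one_mul, sub_eq_zero] at h
      rw [← mul_self_mul_conjTranspose_eq_zero, Matrix.sub_mul, Matrix.one_mul, sub_eq_zero]
      suffices h : cfc f (lam * lamᴴ) * cfc (fun x : ℝ => x) (lam * lamᴴ) =
          cfc (fun x : ℝ => x) (lam * lamᴴ) by rwa [cfc_id' ℝ (lam * lamᴴ) hsa] at h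
      rw [← cfc_mul f _ _ (hcont _) (hcont _)]
      congr 1
      ext x
      by_cases hx : x = 0 <;> simp [f, hx]
  rw [hf] at h1
  exact hpos.posDef_iff_isUnit.mpr (IsUnit.of_mul_eq_one_right _ h1)

/-- Theorem on optimal nondegenerate strategies: for an
optimal nondegenerate quantum strategy of a game with no zero rows or columns,
the marginal density matrix `ρ = λλᴴ` commutes with every `B j`, is positive
definite, and `(∑ j G i j • B j)² = c i ² • I` for all `i`. -/
theorem optimal_strategy_marginal_properties {m n d₁ d₂ : ℕ}
    (G : Matrix (Fin m) (Fin n) ℝ) (hG : isXORGame G)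
    (hrows : ∀ i, ∃ j, G i j ≠ 0) (hcols : ∀ j, ∃ i, G i j ≠ 0)
    (c : Fin m → ℝ) (hc : isMarginalRowBiases G c)
    (d : Fin n → ℝ) (hd : isMarginalColBiases G d)
    (A : Fin m → Matrix (Fin d₁) (Fin d₁) ℂ)
    (hA : ∀ i, (A i).IsHermitian ∧ (A i) ^ 2 = 1)
    (B : Fin n → Matrix (Fin d₂) (Fin d₂) ℂ)
    (hB : ∀ j, (B j).IsHermitian ∧ (B j) ^ 2 = 1)
    (lam : Matrix (Fin d₂) (Fin d₁) ℂ) (hlam : frobNorm lam = 1)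
    (ψ : Fin d₁ × Fin d₂ → ℂ) (hψ : ψ = fun p => lam p.2 p.1)
    (hopt : qStratBias G A B ψ = (quantumBias G : ℂ))
    (hnd : Nondegenerate A B ψ) :
    (∀ j, lam * lamᴴ * B j = B j * (lam * lamᴴ)) ∧
    (lam * lamᴴ).PosDef ∧
    (∀ i, (∑ j, (G i j : ℂ) • B j) ^ 2 = ((c i : ℂ)) ^ 2 • 1) := by
  have hA2 : ∀ i, (A i)ᵀ * (A i)ᵀ = 1 := fun i => by
    rw [← transpose_mul, ← sq, (hA i).2, transpose_one]
  have hAT : ∀ i, ((A i)ᵀ)ᴴ = (A i)ᵀ := fun i => (hA i).1.transpose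
  have hψ' : ψ = vec lam := hψ
  let u : Fin m → EuclideanSpace ℂ (Fin d₁ × Fin d₂) := fun i =>
    WithLp.toLp 2 (vec (lam * (A i)ᵀ))
  let v : Fin n → EuclideanSpace ℂ (Fin d₁ × Fin d₂) := fun j => WithLp.toLp 2 (vec (B j * lam))
  have hu : ∀ i, ‖u i‖ = 1 := fun i => by
    rw [norm_toLp_vec, ← hlam]
    refine frobNorm_eq_of_gram_trace_eq ?_
    rw [conjTranspose_mul, hAT, Matrix.mul_assoc, trace_mul_comm, Matrix.mul_assoc,
      Matrix.mul_assoc, hA2, Matrix.mul_one]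
  have hv : ∀ j, ‖v j‖ = 1 := fun j => by
    rw [norm_toLp_vec, ← hlam]
    refine frobNorm_eq_of_gram_trace_eq ?_
    rw [conjTranspose_mul, (hB j).1.eq, Matrix.mul_assoc, ← Matrix.mul_assoc (B j), ← sq,
      (hB j).2, Matrix.one_mul]
  have hb : ∑ i, ∑ j, G i j * ⟪u i, v j⟫ = quantumBias G := by
    have := congrArg Complex.re hopt
    rw [Complex.ofReal_re, qStratBias, Complex.re_sum] at this
    rw [← this]
    refine Finset.sum_congr rfl fun i _ => ?_
    rw [Complex.re_sum]
    refine Finset.sum_congr rfl fun j _ => ?_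
    rw [Complex.re_ofReal_mul, inner_toLp_vec, hψ', kronecker_mulVec_vec]
    have : cinner (vec lam) (vec (B j * lam * (A i)ᵀ)) =
        star (vec lam) ⬝ᵥ vec (B j * lam * (A i)ᵀ) := rfl
    rw [this, star_vec_dotProduct_vec, conjTranspose_mul, hAT, Matrix.mul_assoc, trace_mul_comm,
      Matrix.mul_assoc, Matrix.mul_assoc]
  obtain ⟨hcol, hrow, hd0⟩ := marginal_relations hcols hc hd hu hv hb
  have hcolM : ∀ j, lam * ∑ i, (G i j : ℂ) • (A i)ᵀ = (d j : ℂ) • (B j * lam) := fun j => by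
    apply vec_inj.mp
    have := congrArg WithLp.ofLp (hcol j)
    ext p
    have := congrFun this p
    simpa [u, v, Matrix.mul_sum, Matrix.sum_apply, vec_sum, vec_smul] using this
  have hrowM : ∀ i, (∑ j, (G i j : ℂ) • B j) * lam = (c i : ℂ) • (lam * (A i)ᵀ) := fun i => by
    apply vec_inj.mp
    have := congrArg WithLp.ofLp (hrow i)
    ext p
    have := congrFun this p
    simpa [u, v, Matrix.sum_mul, Matrix.sum_apply, vec_sum, vec_smul] using this
  have hcomm : ∀ j, lam * lamᴴ * B j = B j * (lam * lamᴴ) := fun j => by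
    have hX : (∑ i, (G i j : ℂ) • (A i)ᵀ)ᴴ = ∑ i, (G i j : ℂ) • (A i)ᵀ := by
      simp [conjTranspose_sum, conjTranspose_smul, hAT]
    have hdj : (d j : ℂ) ≠ 0 := Complex.ofReal_ne_zero.mpr (hd0 j)
    have h1 := congrArg (fun M => M * lamᴴ) (hcolM j)
    have h2 := congrArg (fun M => lam * Mᴴ) (hcolM j)
    simp only [conjTranspose_mul, conjTranspose_smul, hX, (hB j).1.eq, Complex.star_def,
      Complex.conj_ofReal, Matrix.smul_mul, Matrix.mul_smul, ← Matrix.mul_assoc] at h1 h2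
    rw [h1] at h2
    rw [← Matrix.mul_assoc]
    exact (smul_right_injective _ hdj h2).symm
  have hpd : (lam * lamᴴ).PosDef := by
    refine posDef_mul_conjTranspose_of_commute hcomm fun Q hQh hQQ hQB hQl => ?_
    by_contra hne
    refine hnd.2 ⟨Q, hne, hQh, hQQ, hQB, ?_⟩
    rw [hψ', kronecker_mulVec_vec, hQl, transpose_one, Matrix.mul_one]
  refine ⟨hcomm, hpd, fun i => ?_⟩
  have hS : (∑ j, (G i j : ℂ) • B j) ^ 2 * lam = (c i : ℂ) ^ 2 • lam := by
    rw [sq, Matrix.mul_assoc, hrowM, Matrix.mul_smul, ← Matrix.mul_assoc, hrowM, Matrix.smul_mul,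
      Matrix.mul_assoc, hA2, Matrix.mul_one, smul_smul, sq]
  refine hpd.isUnit.mul_right_cancel ?_
  rw [← Matrix.mul_assoc, hS, Matrix.smul_mul, Matrix.smul_mul, Matrix.one_mul]
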